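/- For every integer n ≥ 1 and every integer d ≥ 0, the image under the quotient map ℝ[s,t] → ℝ[s,t]/(f_{n+1}, f_{n+2}) of the ℝ-subspace of weighted-homogeneous polynomials of weighted degree d has dimension ⌊min(d, 2n-d)/2⌋ + 1 if 0 ≤ d ≤ 2n, and dimension 0 if d > 2n. (Equivalently, the Poincaré series of the graded algebra ℝ[s,t]/(f_{n+1}, f_{n+2}) is (1-x^{n+1})(1-x^{n+2})/((1-x)(1-x^2)).) -/

import Mathlib

open MvPolynomial Finset

/-- The weighted-degree-`k` component of `log(1+s+t)` in `ℝ[s,t]`,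
where `s = X 0` has degree 2 and `t = X 1` has degree 1. -/
noncomputable def f (k : ℕ) : MvPolynomial (Fin 2) ℝ :=
  (-1 : ℝ) ^ (k + 1) •
    ∑ i ∈ Finset.range (k / 2 + 1),
      (((-1 : ℝ) ^ i / ((k : ℝ) - i)) * (Nat.choose (k - i) i)) •
        (X 0 ^ i * X 1 ^ (k - 2 * i))


noncomputable def PP : ℕ → MvPolynomial (Fin 2) ℝ
  | 0 => 2
  | 1 => X 1
  | (k+2) => X 1 * PP (k+1) - X 0 * PP k

noncomputable def bb (k i : ℕ) : ℝ := (-1 : ℝ) ^ i * (k / ((k : ℝ) - i)) * (Nat.choose (k - i) i)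

lemma bb_zero_of (k i : ℕ) (hk : 1 ≤ k) (h : k < 2 * i) : bb k i = 0 := by
  unfold bb
  rw [Nat.choose_eq_zero_of_lt (by omega)]; simp

lemma bb_rec (k i : ℕ) (hk : 1 ≤ k) : bb (k+2) (i+1) = bb (k+1) (i+1) - bb k i := by
  rcases le_or_gt k i with h | h
  · rw [bb_zero_of _ _ (by omega) (by omega), bb_zero_of _ _ (by omega) (by omega),
      bb_zero_of _ _ (by omega) (by omega)]; simp
  · obtain ⟨m, rfl⟩ : ∃ m, k = i + m + 1 := ⟨k - i - 1, by omega⟩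
    unfold bb
    have e1 : i + m + 1 + 2 - (i+1) = m + 2 := by omega
    have e2 : i + m + 1 + 1 - (i+1) = m + 1 := by omega
    have e3 : i + m + 1 - i = m + 1 := by omega
    rw [e1, e2, e3, Nat.choose_succ_succ (m+1) i]
    have h1 : (i + 1 : ℝ) * ((m+1).choose (i+1)) = (m + 1 - i) * ((m+1).choose i) := by
      rcases le_or_gt i (m+1) with h2 | h2
      · have := Nat.choose_succ_right_eq (m+1) i
        have h3 := congrArg (Nat.cast : ℕ → ℝ) this
        push_cast [h2] at h3
        linarith
      · rw [Nat.choose_eq_zero_of_lt h2, Nat.choose_eq_zero_of_lt (by omega)]; simp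
    have d1 : (m + 2 : ℝ) ≠ 0 := by positivity
    have d2 : (m + 1 : ℝ) ≠ 0 := by positivity
    push_cast
    have g1 : ((i:ℝ) + m + 1 + 2 - (i + 1)) = m + 2 := by ring
    have g2 : ((i:ℝ) + m + 1 + 1 - (i + 1)) = m + 1 := by ring
    have g3 : ((i:ℝ) + m + 1 - i) = m + 1 := by ring
    rw [g1, g2, g3, pow_succ]
    generalize ((m+1).choose (i+1) : ℝ) = B at *
    generalize ((m+1).choose i : ℝ) = A at *
    field_simp
    linear_combination h1

lemma bb_zero_right (k : ℕ) (hk : 1 ≤ k) : bb k 0 = 1 := by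
  have : (k : ℝ) ≠ 0 := by positivity
  simp [bb, this]

lemma PP_eq (k : ℕ) : ∀ N, k + 1 < 2 * N → 
    PP (k+1) = ∑ i ∈ Finset.range N, bb (k+1) i • (X 0 ^ i * X 1 ^ (k + 1 - 2 * i)) := by
  induction k using Nat.strong_induction_on with
  | _ k ih =>
    intro N hN
    match k, N, hN, ih with
    | 0, N+1, hN, ih =>
      rw [Finset.sum_range_succ', Finset.sum_eq_zero]
      · simp [PP, bb_zero_right]
      · intro i hi
        rw [bb_zero_of _ _ (by omega) (by omega), zero_smul]
    | 1, N+2, hN, ih =>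
      rw [Finset.sum_range_succ', Finset.sum_range_succ', Finset.sum_eq_zero]
      · simp only [PP, bb]
        have h2 : (C 2 : MvPolynomial (Fin 2) ℝ) = 2 := map_ofNat C 2
        norm_num [smul_eq_C_mul, h2]
        ring
      · intro i hi
        rw [bb_zero_of _ _ (by omega) (by omega), zero_smul]
    | k+2, N+1, hN, ih =>
      have h1 := ih (k+1) (by omega) (N+1) (by omega)
      have h2 := ih k (by omega) N (by omega)
      change X 1 * PP (k+1+1) - X 0 * PP (k+1) = _
      rw [h1, h2, Finset.sum_range_succ', Finset.sum_range_succ', mul_add, Finset.mul_sum,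
        Finset.mul_sum, add_sub_right_comm, ← Finset.sum_sub_distrib]
      congr 1
      · refine Finset.sum_congr rfl fun i _ => ?_
        rw [bb_rec (k+1) i (by omega), sub_smul]
        congr 1
        · rcases le_or_gt (2*(i+1)) (k+1+1) with h | h
          · rw [show k + 2 + 1 - 2 * (i+1) = (k+1+1 - 2*(i+1)) + 1 by omega]
            simp only [smul_eq_C_mul]; ring
          · rw [bb_zero_of _ _ (by omega) h]; simp
        · rw [show k + 2 + 1 - 2 * (i+1) = (k+1 - 2*i) by omega]
          simp only [smul_eq_C_mul]; ring
      · rw [bb_zero_right _ (by omega), bb_zero_right _ (by omega)]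
        simp; ring

lemma f_eq (k : ℕ) : f (k+1) = C ((-1 : ℝ)^(k+1+1) / ((k+1 : ℕ) : ℝ)) * PP (k+1) := by
  rw [PP_eq k ((k+1)/2+1) (by omega), f, ← smul_eq_C_mul, Finset.smul_sum, Finset.smul_sum]
  refine Finset.sum_congr rfl fun i hi => ?_
  rw [smul_smul, smul_smul]
  congr 1
  unfold bb
  have : ((k+1 : ℕ) : ℝ) ≠ 0 := by positivity
  field_simp

lemma f_eq' (k : ℕ) : ∃ u : (MvPolynomial (Fin 2) ℝ)ˣ, f (k+1) = u * PP (k+1) := by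
  have h : IsUnit (C ((-1 : ℝ)^(k+1+1) / ((k+1 : ℕ) : ℝ)) : MvPolynomial (Fin 2) ℝ) := by
    apply IsUnit.map
    rw [isUnit_iff_ne_zero]
    have : ((k+1 : ℕ) : ℝ) ≠ 0 := by positivity
    positivity
  exact ⟨h.unit, f_eq k⟩

lemma two_unit : IsUnit (2 : MvPolynomial (Fin 2) ℝ) := by
  have : (2 : MvPolynomial (Fin 2) ℝ) = C 2 := (map_ofNat C 2).symm
  rw [this]
  apply IsUnit.map
  simp

lemma relX : IsRelPrime (X 1 : MvPolynomial (Fin 2) ℝ) (X 0) := by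
  rw [(X_prime (R := ℝ) (i := (1 : Fin 2))).irreducible.isRelPrime_iff_not_dvd, X_dvd_X]
  simp

lemma rel_sub {R : Type*} [CommRing R] {a b c : R} (h : IsRelPrime a b) :
    IsRelPrime a (a * c - b) := by
  intro d h1 h2
  refine h h1 ?_
  have := dvd_sub (h1.mul_right c) h2
  simpa using this

lemma relS (k : ℕ) : IsRelPrime (X 0) (PP k) := by
  induction k using Nat.strong_induction_on with
  | _ k ih =>
    match k, ih with
    | 0, _ => exact two_unit.isRelPrime_right
    | 1, _ => exact relX.symm
    | k+2, ih =>
      have h1 : IsRelPrime (X 0) (X 1 * PP (k+1)) := relX.symm.mul_right (ih _ (by omega))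
      intro d h2 h3
      refine h1 h2 ?_
      have := dvd_add h3 (h2.mul_right (PP k))
      simpa [PP] using this

lemma relP (k : ℕ) : IsRelPrime (PP k) (PP (k+1)) := by
  induction k with
  | zero => exact two_unit.isRelPrime_left
  | succ k ih =>
    change IsRelPrime (PP (k+1)) (X 1 * PP (k+1) - X 0 * PP k)
    rw [mul_comm (X 1)]
    exact rel_sub ((relS _).symm.mul_right ih.symm)

lemma relF (n : ℕ) : IsRelPrime (f (n+1)) (f (n+2)) := by
  obtain ⟨u, hu⟩ := f_eq' n
  obtain ⟨v, hv⟩ := f_eq' (n+1)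
  rw [hu, hv]
  intro d h1 h2
  exact relP (n+1) ((Units.dvd_mul_left).1 h1) ((Units.dvd_mul_left).1 h2)

lemma PP_ne (k : ℕ) : PP k ≠ 0 := by
  intro h
  have := relS k
  rw [h, isRelPrime_zero_right] at this
  exact (X_prime (R := ℝ) (i := (0 : Fin 2))).not_isUnit this

lemma f_ne (k : ℕ) : f (k+1) ≠ 0 := by
  obtain ⟨u, hu⟩ := f_eq' k
  rw [hu]
  exact mul_ne_zero u.ne_zero (PP_ne _)

abbrev ww : Fin 2 → ℤ := ![2, 1]

noncomputable abbrev VV (e : ℤ) : Submodule ℝ (MvPolynomial (Fin 2) ℝ) :=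
  weightedHomogeneousSubmodule ℝ ww e

lemma PP_mem (k : ℕ) : IsWeightedHomogeneous ww (PP k) (k : ℤ) := by
  have hX0 := isWeightedHomogeneous_X ℝ ww 0
  have hX1 := isWeightedHomogeneous_X ℝ ww 1
  induction k using Nat.strong_induction_on with
  | _ k ih =>
    match k, ih with
    | 0, _ => 
      have : PP 0 = C 2 := (map_ofNat C 2).symm
      rw [this]; exact isWeightedHomogeneous_C ww 2
    | 1, _ => exact hX1
    | k+2, ih =>
      have h1 := hX1.mul (ih (k+1) (by omega))
      have h2 := hX0.mul (ih k (by omega))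
      have e1 : ww 1 + ((k+1 : ℕ) : ℤ) = ((k+2 : ℕ) : ℤ) := by simp [ww]; ring
      have e2 : ww 0 + (k : ℤ) = ((k+2 : ℕ) : ℤ) := by simp [ww]; ring
      rw [e1] at h1
      rw [e2] at h2
      exact (VV _).sub_mem h1 h2

lemma f_mem (k : ℕ) : f (k+1) ∈ VV ((k+1 : ℕ) : ℤ) := by
  rw [f_eq, ← smul_eq_C_mul]
  exact (VV _).smul_mem _ (PP_mem _)

lemma weight_ww (x : Fin 2 →₀ ℕ) : Finsupp.weight ww x = 2 * (x 0 : ℤ) + x 1 := by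
  rw [Finsupp.weight_apply, Finsupp.sum_fintype _ _ (by simp), Fin.sum_univ_two]
  simp [ww]; ring

lemma weight_nat (x : Fin 2 →₀ ℕ) : Finsupp.weight (![2, 1] : Fin 2 → ℕ) x = 2 * x 0 + x 1 := by
  rw [Finsupp.weight_apply, Finsupp.sum_fintype _ _ (by simp), Fin.sum_univ_two]
  simp; ring

lemma VV_nat (d : ℕ) : weightedHomogeneousSubmodule ℝ (![2, 1] : Fin 2 → ℕ) d = VV (d : ℤ) := by
  ext p
  rw [mem_weightedHomogeneousSubmodule, mem_weightedHomogeneousSubmodule]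
  unfold IsWeightedHomogeneous
  refine forall_congr' fun x => forall_congr' fun _ => ?_
  rw [weight_ww, weight_nat]
  omega

noncomputable def VVequiv (e : ℤ) :
    {x : Fin 2 →₀ ℕ | Finsupp.weight ww x = e} ≃ Fin (e / 2 + 1).toNat where
  toFun x := ⟨x.1 0, by
    have := x.2
    rw [Set.mem_ofPred_eq, weight_ww] at this
    omega⟩
  invFun i := ⟨Finsupp.equivFunOnFinite.symm ![i.1, (e - 2 * i.1).toNat], by
    have := i.2
    rw [Set.mem_ofPred_eq, weight_ww]
    simp
    omega⟩
  left_inv x := by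
    have := x.2
    rw [Set.mem_ofPred_eq, weight_ww] at this
    ext j
    fin_cases j
    · simp
    · simp; omega
  right_inv i := by
    simp

noncomputable def VVbasis (e : ℤ) : Module.Basis (Fin (e / 2 + 1).toNat) ℝ (VV e) :=
  ((basisRestrictSupport ℝ {x | Finsupp.weight ww x = e}).reindex (VVequiv e)).map
    (LinearEquiv.ofEq _ _ (weightedHomogeneousSubmodule_eq_finsupp_supported ℝ ww e).symm)

instance (e : ℤ) : Module.Finite ℝ (VV e) := Module.Finite.of_basis (VVbasis e)

lemma finrank_VV (e : ℤ) : Module.finrank ℝ (VV e) = (e / 2 + 1).toNat := by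
  simpa using Module.finrank_eq_card_basis (VVbasis e)

lemma finrank_map_add {V W : Type*} [AddCommGroup V] [Module ℝ V] [AddCommGroup W] [Module ℝ W]
    (L : V →ₗ[ℝ] W) (S : Submodule ℝ V) [Module.Finite ℝ S] :
    Module.finrank ℝ (S.map L) + Module.finrank ℝ (S ⊓ LinearMap.ker L : Submodule ℝ V)
      = Module.finrank ℝ S := by
  have h := LinearMap.finrank_range_add_finrank_ker (L.domRestrict S)
  rw [LinearMap.range_domRestrict] at h
  rw [← h, LinearMap.ker_domRestrict, ← Submodule.finrank_map_subtype_eq,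
    Submodule.map_comap_subtype]

lemma mul_mem_VV {p q : MvPolynomial (Fin 2) ℝ} {a b c : ℤ} (hp : p ∈ VV a) (hq : q ∈ VV b)
    (h : a + b = c) : p * q ∈ VV c := by
  subst h
  exact IsWeightedHomogeneous.mul hp hq

/-- the degree `e` component -/
noncomputable def cp (e : ℤ) (p : MvPolynomial (Fin 2) ℝ) : MvPolynomial (Fin 2) ℝ :=
  letI := weightedGradedAlgebra ℝ ww
  (DirectSum.decompose VV p e : MvPolynomial (Fin 2) ℝ)

lemma cp_mem (e : ℤ) (p) : cp e p ∈ VV e := by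
  unfold cp
  exact SetLike.coe_mem _

lemma cp_same {e : ℤ} {p} (h : p ∈ VV e) : cp e p = p :=
  letI := weightedGradedAlgebra ℝ ww
  DirectSum.decompose_of_mem_same VV h

lemma cp_add (e : ℤ) (p q) : cp e (p + q) = cp e p + cp e q := by
  simp [cp, DirectSum.decompose_add]

lemma cp_mul {a b c : ℤ} (p) {q} (h : q ∈ VV b) (hc : a + b = c) : cp c (p * q) = cp a p * q := by
  subst hc
  letI := weightedGradedAlgebra ℝ ww
  exact DirectSum.coe_decompose_mul_add_of_right_mem VV h

/-- `(u, v) ↦ u f + v g` -/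
noncomputable def phi (p q : MvPolynomial (Fin 2) ℝ) :
    (MvPolynomial (Fin 2) ℝ × MvPolynomial (Fin 2) ℝ) →ₗ[ℝ] MvPolynomial (Fin 2) ℝ :=
  (LinearMap.mulRight ℝ p).coprod (LinearMap.mulRight ℝ q)

/-- `w ↦ (w g, -w f)` -/
noncomputable def psi (p q : MvPolynomial (Fin 2) ℝ) :
    MvPolynomial (Fin 2) ℝ →ₗ[ℝ] (MvPolynomial (Fin 2) ℝ × MvPolynomial (Fin 2) ℝ) :=
  (LinearMap.mulRight ℝ q).prod (LinearMap.mulRight ℝ (-p))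

lemma ker_phi {p q : MvPolynomial (Fin 2) ℝ} {a b d : ℤ} (hp : p ∈ VV a) (hq : q ∈ VV b)
    (hq0 : q ≠ 0) (h : IsRelPrime p q) :
    (Submodule.prod (VV (d - a)) (VV (d - b))) ⊓ LinearMap.ker (phi p q)
      = (VV (d - a - b)).map (psi p q) := by
  ext ⟨u, v⟩
  simp only [Submodule.mem_inf, Submodule.mem_prod, LinearMap.mem_ker, Submodule.mem_map, phi, psi,
    LinearMap.coprod_apply, LinearMap.mulRight_apply, LinearMap.prod_apply, Function.prod, Prod.mk.injEq]
  constructor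
  · rintro ⟨⟨hu, hv⟩, h0⟩
    have hd : q ∣ u * p := ⟨-v, by linear_combination h0⟩
    obtain ⟨w, rfl⟩ := h.symm.dvd_of_dvd_mul_right hd
    have e1 : w * q = cp (d - a - b) w * q := by
      rw [← cp_mul w hq (c := d - a) (by ring), cp_same]
      rwa [mul_comm]
    have e2 := mul_right_cancel₀ hq0 e1
    refine ⟨w, ?_, mul_comm _ _, ?_⟩
    · rw [e2]; exact cp_mem _ _
    · apply mul_right_cancel₀ hq0
      linear_combination -h0
  · rintro ⟨w, hw, rfl, rfl⟩
    refine ⟨⟨mul_mem_VV hw hq (by ring), mul_mem_VV hw ((VV a).neg_mem hp) (by ring)⟩, by ring⟩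

lemma range_phi {p q : MvPolynomial (Fin 2) ℝ} {a b d : ℤ} (hp : p ∈ VV a) (hq : q ∈ VV b) :
    (Submodule.prod (VV (d - a)) (VV (d - b))).map (phi p q)
      = VV d ⊓ LinearMap.ker (Ideal.Quotient.mkₐ ℝ (Ideal.span {p, q})).toLinearMap := by
  ext r
  simp only [Submodule.mem_inf, Submodule.mem_prod, LinearMap.mem_ker, Submodule.mem_map, phi,
    LinearMap.coprod_apply, LinearMap.mulRight_apply, Prod.exists, AlgHom.toLinearMap_apply,
    Ideal.Quotient.mkₐ_eq_mk, Ideal.Quotient.eq_zero_iff_mem, Ideal.mem_span_pair]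
  constructor
  · rintro ⟨u, v, ⟨hu, hv⟩, rfl⟩
    exact ⟨(VV d).add_mem (mul_mem_VV hu hp (by ring)) (mul_mem_VV hv hq (by ring)), u, v, rfl⟩
  · rintro ⟨hr, u, v, rfl⟩
    refine ⟨cp (d - a) u, cp (d - b) v, ⟨cp_mem _ _, cp_mem _ _⟩, ?_⟩
    rw [← cp_mul u hp (c := d) (by ring), ← cp_mul v hq (c := d) (by ring), ← cp_add, cp_same hr]

noncomputable def prodE (a b : ℤ) : Submodule.prod (VV a) (VV b) ≃ₗ[ℝ] (VV a × VV b) where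
  toFun x := (⟨x.1.1, x.2.1⟩, ⟨x.1.2, x.2.2⟩)
  invFun x := ⟨(x.1.1, x.2.1), ⟨x.1.2, x.2.2⟩⟩
  map_add' _ _ := rfl
  map_smul' _ _ := rfl
  left_inv _ := rfl
  right_inv _ := rfl

instance (a b : ℤ) : Module.Finite ℝ (Submodule.prod (VV a) (VV b)) :=
  Module.Finite.equiv (prodE a b).symm

lemma main_count {p q : MvPolynomial (Fin 2) ℝ} {a b d : ℤ} (hp : p ∈ VV a) (hq : q ∈ VV b)
    (hq0 : q ≠ 0) (h : IsRelPrime p q) :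
    Module.finrank ℝ ((VV d).map (Ideal.Quotient.mkₐ ℝ (Ideal.span {p, q})).toLinearMap)
      + ((d - a) / 2 + 1).toNat + ((d - b) / 2 + 1).toNat
      = (d / 2 + 1).toNat + ((d - a - b) / 2 + 1).toNat := by
  have h1 := finrank_map_add (Ideal.Quotient.mkₐ ℝ (Ideal.span {p, q})).toLinearMap (VV d)
  have h2 := finrank_map_add (phi p q) (Submodule.prod (VV (d - a)) (VV (d - b)))
  have hinj : Function.Injective (psi p q) := by
    intro x y hxy
    have := congrArg Prod.fst hxy
    exact mul_right_cancel₀ hq0 this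
  rw [ker_phi hp hq hq0 h, range_phi hp hq, ← (Submodule.equivMapOfInjective _ hinj _).finrank_eq,
    (prodE _ _).finrank_eq, Module.finrank_prod] at h2
  simp only [finrank_VV] at h1 h2
  omega

theorem stmt17 (n d : ℕ) (hn : 1 ≤ n) :
    Module.finrank ℝ
        (Submodule.map
          (Ideal.Quotient.mkₐ ℝ (Ideal.span {f (n + 1), f (n + 2)})).toLinearMap
          (MvPolynomial.weightedHomogeneousSubmodule ℝ ![2, 1] d))
      = if d ≤ 2 * n then min d (2 * n - d) / 2 + 1 else 0 := by
  rw [VV_nat]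
  have h := main_count (d := d) (f_mem n) (f_mem (n+1)) (f_ne (n+1)) (relF n)
  change Module.finrank ℝ ((VV d).map
    (Ideal.Quotient.mkₐ ℝ (Ideal.span {f (n + 1), f (n + 2)})).toLinearMap) + _ + _ = _ at h
  push_cast at h
  split_ifs <;> omega
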